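/- arXiv:math/0603364 — 3 statements merged into one kernel-verified Lean document; each statement's English description precedes it below -/
import Mathlib

section
/- Let q be a prime power, w ≥ 1, K = GF(q^w), F = GF(q), V an A-dimensional K-vector space with A even, Q : V → K a non-degenerate quadratic form admitting no totally singular K-subspace of dimension A/2 (i.e., (V,Q) is of type O^−), and L : K → F a nonzero F-linear map. Then LQ = L∘Q is a non-degenerate quadratic form on the Aw-dimensional F-vector space V admitting no totally singular F-subspace of dimension Aw/2; that is, (V,LQ) is of type O^−(Aw,q). -/
open Module

section GaussSum

variable {V : Type*} [AddCommGroup V] [Fintype V]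

/-- The modulus of a quadratic Gauss sum whose associated bicharacter is non-degenerate. -/
theorem normSq_sum_of_quadratic (f : V → ℂ) (b : V → AddChar V ℂ)
    (hf : ∀ x, ‖f x‖ = 1) (hadd : ∀ x y, f (x + y) = f x * f y * b x y)
    (hf0 : f 0 = 1) (hb : ∀ x, b x = 0 → x = 0) :
    Complex.normSq (∑ x, f x) = Fintype.card V := by
  classical
  have hunit (y : V) : f y * (starRingEnd ℂ) (f y) = 1 := by
    rw [Complex.mul_conj, Complex.normSq_eq_norm_sq, hf]
    norm_num
  have key : (∑ x, f x) * (starRingEnd ℂ) (∑ x, f x) = (Fintype.card V : ℂ) := by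
    calc (∑ x, f x) * (starRingEnd ℂ) (∑ x, f x)
        = ∑ y, ∑ x, f x * (starRingEnd ℂ) (f y) := by
          rw [map_sum, Finset.mul_sum]
          exact Finset.sum_congr rfl fun y _ ↦ Finset.sum_mul _ _ _
      _ = ∑ y, ∑ z, f (z + y) * (starRingEnd ℂ) (f y) := by
          refine Finset.sum_congr rfl fun y _ ↦ ?_
          exact (Equiv.sum_comp (Equiv.addRight y) fun x ↦ f x * (starRingEnd ℂ) (f y)).symm
      _ = ∑ y, ∑ z, f z * b z y := by
          refine Finset.sum_congr rfl fun y _ ↦ Finset.sum_congr rfl fun z _ ↦ ?_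
          rw [hadd]
          linear_combination f z * b z y * hunit y
      _ = ∑ z, f z * ∑ y, b z y := by
          rw [Finset.sum_comm]
          simp_rw [Finset.mul_sum]
      _ = (Fintype.card V : ℂ) := by
          rw [Finset.sum_eq_single 0]
          · have h1 : b 0 = 0 := by
              ext y
              have := hadd 0 y
              rw [zero_add, hf0, one_mul] at this
              have hne : f y ≠ 0 := fun h ↦ by simpa [h] using hf y
              exact (mul_left_cancel₀ hne (by rw [← this]; simp)).symm
            simp [h1, hf0]
          · intro z _ hz
            rw [AddChar.sum_eq_ite, if_neg fun h ↦ hz (hb z h), mul_zero]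
          · simp
  rw [Complex.mul_conj] at key
  exact_mod_cast key

/-- A quadratic Gauss sum may be restricted to the annihilator of a subgroup on which the
summand is trivial. -/
theorem sum_quadratic_eq_sum_annihilator (f : V → ℂ) (b : V → AddChar V ℂ)
    (hadd : ∀ x y, f (x + y) = f x * f y * b x y) (W : AddSubgroup V)
    (hW : ∀ y ∈ W, f y = 1) [DecidablePred fun x ↦ ∀ y ∈ W, b x y = 1] :
    ∑ x, f x = ∑ x with ∀ y ∈ W, b x y = 1, f x := by
  classical
  have hcard : (Fintype.card W : ℂ) ≠ 0 := Nat.cast_ne_zero.2 Fintype.card_ne_zero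
  apply mul_left_cancel₀ hcard
  calc (Fintype.card W : ℂ) * ∑ x, f x = ∑ y : W, ∑ x, f (x + y) := by
        have (y : W) : ∑ x, f (x + y) = ∑ x, f x := 
          Equiv.sum_comp (Equiv.addRight (y : V)) f
        simp [this]
    _ = ∑ x, f x * ∑ y : W, b x y := by
        rw [Finset.sum_comm]
        refine Finset.sum_congr rfl fun x _ ↦ ?_
        rw [Finset.mul_sum]
        refine Finset.sum_congr rfl fun y _ ↦ ?_
        rw [hadd, hW y y.2, mul_one]
    _ = ∑ x, if ∀ y ∈ W, b x y = 1 then (Fintype.card W : ℂ) * f x else 0 := by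
        refine Finset.sum_congr rfl fun x _ ↦ ?_
        have h := AddChar.sum_eq_ite ((b x).compAddMonoidHom W.subtype)
        have hiff : (b x).compAddMonoidHom W.subtype = 0 ↔ ∀ y ∈ W, b x y = 1 := by
          simp [DFunLike.ext_iff]
        simp only [hiff, AddChar.compAddMonoidHom_apply, AddSubgroup.subtype_apply] at h
        rw [h]
        split_ifs <;> ring
    _ = (Fintype.card W : ℂ) * ∑ x with ∀ y ∈ W, b x y = 1, f x := by
        rw [Finset.mul_sum, Finset.sum_filter]

/-- The order of the annihilator of a subgroup under a non-degenerate symmetric bicharacter. -/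
theorem card_mul_card_annihilator (b : V → AddChar V ℂ) (hsymm : ∀ x y, b x y = b y x)
    (hb : ∀ x, b x = 0 → x = 0) (W : AddSubgroup V)
    [DecidablePred fun x ↦ ∀ y ∈ W, b x y = 1] :
    Nat.card W * Finset.card {x | ∀ y ∈ W, b x y = 1} = Nat.card V := by
  classical
  have h0 : b 0 = 0 := by
    ext y
    rw [hsymm]
    simp
  have h1 : ∑ x, ∑ y : W, b x y = (Fintype.card W : ℂ) * Finset.card {x | ∀ y ∈ W, b x y = 1} := by
    rw [Finset.card_filter]
    push_cast
    rw [Finset.mul_sum]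
    refine Finset.sum_congr rfl fun x _ ↦ ?_
    have h := AddChar.sum_eq_ite ((b x).compAddMonoidHom W.subtype)
    have hiff : (b x).compAddMonoidHom W.subtype = 0 ↔ ∀ y ∈ W, b x y = 1 := by
      simp [DFunLike.ext_iff]
    simp only [hiff, AddChar.compAddMonoidHom_apply, AddSubgroup.subtype_apply] at h
    rw [h]
    split_ifs <;> ring
  have h2 : ∑ x, ∑ y : W, b x y = (Fintype.card V : ℂ) := by
    rw [Finset.sum_comm, Finset.sum_eq_single 0]
    · simp_rw [fun x ↦ hsymm x ((0 : W) : V)]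
      simp [h0]
    · intro y _ hy
      simp_rw [fun x ↦ hsymm x (y : V)]
      rw [AddChar.sum_eq_ite, if_neg fun h ↦ hy (Subtype.ext (hb y h))]
    · simp
  rw [h1] at h2
  rw [Nat.card_eq_fintype_card, Nat.card_eq_fintype_card]
  exact_mod_cast h2

end GaussSum

/-- The rank of an alternating form is even. -/
theorem even_finrank_add_finrank_ker_of_isAlt {K V : Type*} [Field K] [AddCommGroup V]
    [Module K V] [FiniteDimensional K V] (B : LinearMap.BilinForm K V) (hB : B.IsAlt) :
    Even (finrank K V + finrank K (LinearMap.ker B)) := by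
  obtain ⟨U, hU⟩ := exists_maximal_of_wellFoundedGT
    (fun U : Submodule K V ↦ U ≤ B.orthogonal U) ⟨⊥, bot_le⟩
  have hrefl : B.IsRefl := hB.isRefl
  have horth : B.orthogonal U = U := by
    refine le_antisymm (fun x hx ↦ ?_) hU.prop
    have hle : U ⊔ K ∙ x ≤ B.orthogonal (U ⊔ K ∙ x) := by
      intro y hy
      rw [LinearMap.BilinForm.mem_orthogonal_iff] at hx ⊢
      intro z hz
      obtain ⟨u, hu, v, hv, rfl⟩ := Submodule.mem_sup.1 hy
      obtain ⟨u', hu', v', hv', rfl⟩ := Submodule.mem_sup.1 hz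
      obtain ⟨c, rfl⟩ := Submodule.mem_span_singleton.1 hv
      obtain ⟨c', rfl⟩ := Submodule.mem_span_singleton.1 hv'
      have h1 : B u' u = 0 := hU.prop hu u' hu'
      have h2 : B u' x = 0 := hx u' hu'
      have h3 : B x u = 0 := hrefl _ _ (hx u hu)
      have h4 : B x x = 0 := hB x
      simp [h1, h2, h3, h4]
    exact hU.le_of_ge hle le_sup_left (Submodule.mem_sup_right (Submodule.mem_span_singleton_self x))
  have h := LinearMap.BilinForm.finrank_add_finrank_orthogonal' (B := B) U
  have hker : LinearMap.ker B ≤ U := by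
    rw [← horth]
    intro x hx
    rw [LinearMap.BilinForm.mem_orthogonal_iff]
    intro n _
    exact hrefl _ _ (by rw [LinearMap.mem_ker.1 hx]; rfl)
  rw [horth, inf_eq_right.2 hker] at h
  exact ⟨_, h.symm⟩

/-- Over a finite field, a non-degenerate quadratic form on an even-dimensional space has a
non-degenerate polar form. -/
theorem ker_polarBilin_eq_bot {K V : Type*} [Field K] [Finite K] [AddCommGroup V]
    [Module K V] [FiniteDimensional K V] (hV : Even (finrank K V)) (Q : QuadraticForm K V)
    (hQ : ∀ u : V, Q u = 0 → (∀ v : V, QuadraticMap.polar Q u v = 0) → u = 0) :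
    LinearMap.ker Q.polarBilin = ⊥ := by
  have hself (x : V) : QuadraticMap.polar Q x x = 2 * Q x := by
    rw [QuadraticMap.polar_self, nsmul_eq_mul, Nat.cast_ofNat]
  have hmem (x : V) (hx : x ∈ LinearMap.ker Q.polarBilin) (y : V) :
      QuadraticMap.polar Q x y = 0 := by
    rw [← QuadraticMap.polarBilin_apply_apply, LinearMap.mem_ker.1 hx]
    rfl
  by_cases h2 : (2 : K) = 0
  · have hchar : ringChar K = 2 := by
      have := CharTwo.of_one_ne_zero_of_two_eq_zero (one_ne_zero (α := K)) h2
      exact ringChar.eq K 2 ▸ rfl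
    have heven := even_finrank_add_finrank_ker_of_isAlt Q.polarBilin
      (fun x ↦ by rw [QuadraticMap.polarBilin_apply_apply, hself, h2, zero_mul])
    by_contra hne
    obtain ⟨x, hx, hx0⟩ := Submodule.exists_mem_ne_zero_of_ne_bot hne
    have hQx : Q x ≠ 0 := fun h ↦ hx0 (hQ x h (hmem x hx))
    have hle : finrank K (LinearMap.ker Q.polarBilin) ≤ 1 := by
      refine finrank_le_one ⟨x, hx⟩ ?_
      rintro ⟨y, hy⟩
      obtain ⟨a, ha⟩ := FiniteField.isSquare_of_char_two hchar (Q y / Q x)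
      refine ⟨a, Subtype.ext ?_⟩
      refine sub_eq_zero.1 (hQ _ ?_ (hmem _ (Submodule.sub_mem _ (Submodule.smul_mem _ a hx) hy)))
      change Q (a • x - y) = 0
      rw [sub_eq_add_neg, QuadraticMap.map_add Q, QuadraticMap.map_smul, QuadraticMap.map_neg,
        hmem _ (Submodule.smul_mem _ a hx), smul_eq_mul, ← ha, div_mul_cancel₀ _ hQx, add_zero,
        ← two_mul, h2, zero_mul]
    have hpos : 0 < finrank K (LinearMap.ker Q.polarBilin) :=
      Submodule.one_le_finrank_iff.2 hne
    obtain ⟨a, ha⟩ := hV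
    obtain ⟨b, hb⟩ := heven
    lia
  · refine (Submodule.eq_bot_iff _).2 fun x hx ↦ hQ x ?_ (hmem x hx)
    have := hmem x hx x
    rw [hself] at this
    exact (mul_eq_zero.1 this).resolve_left h2


/-- The bicharacter associated with a quadratic form and an additive character. -/
noncomputable def polarChar {K V : Type*} [Field K] [AddCommGroup V] [Module K V]
    (Q : QuadraticForm K V) (ψ : AddChar K ℂ) (x : V) : AddChar V ℂ :=
  ψ.compAddMonoidHom (Q.polarBilin x).toAddMonoidHom

section Form

variable {K V : Type*} [Field K] [AddCommGroup V] [Module K V]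
  (Q : QuadraticForm K V) {ψ : AddChar K ℂ}

@[simp]
theorem polarChar_apply (ψ : AddChar K ℂ) (x y : V) :
    polarChar Q ψ x y = ψ (QuadraticMap.polar Q x y) := rfl

theorem polarChar_symm (ψ : AddChar K ℂ) (x y : V) :
    polarChar Q ψ x y = polarChar Q ψ y x := by
  rw [polarChar_apply, polarChar_apply, QuadraticMap.polar_comm]

theorem apply_quadraticForm_add (ψ : AddChar K ℂ) (x y : V) :
    ψ (Q (x + y)) = ψ (Q x) * ψ (Q y) * polarChar Q ψ x y := by
  rw [QuadraticMap.map_add Q, AddChar.map_add_eq_mul, AddChar.map_add_eq_mul, polarChar_apply]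

/-- A nontrivial additive character of a field is nontrivial on every nonzero subspace. -/
theorem eq_zero_of_forall_addChar_mul (hψ : ψ ≠ 0) {a : K} (h : ∀ c : K, ψ (c * a) = 1) :
    a = 0 := by
  by_contra ha
  refine hψ (DFunLike.ext _ _ fun t ↦ ?_)
  simpa [div_mul_cancel₀ t ha] using h (t / a)

theorem eq_zero_of_polarChar_eq_zero (hψ : ψ ≠ 0) (hQ : LinearMap.ker Q.polarBilin = ⊥) (x : V)
    (hx : polarChar Q ψ x = 0) : x = 0 := by
  rw [← Submodule.mem_bot K, ← hQ, LinearMap.mem_ker]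
  ext y
  refine eq_zero_of_forall_addChar_mul hψ fun c ↦ ?_
  have := DFunLike.congr_fun hx (c • y)
  simpa [QuadraticMap.polar_smul_right] using this

theorem mulShift_ne_zero (hψ : ψ ≠ 0) {c : K} (hc : c ≠ 0) : ψ.mulShift c ≠ 0 := by
  intro h
  refine hc (eq_zero_of_forall_addChar_mul hψ fun t ↦ ?_)
  rw [mul_comm, ← AddChar.mulShift_apply, h, AddChar.zero_apply]

theorem normSq_gaussSum_quadraticForm [Finite K] [Fintype V] (hψ : ψ ≠ 0)
    (hQ : LinearMap.ker Q.polarBilin = ⊥) :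
    Complex.normSq (∑ x, ψ (Q x)) = Fintype.card V :=
  normSq_sum_of_quadratic (fun x ↦ ψ (Q x)) (polarChar Q ψ) (fun _ ↦ AddChar.norm_apply _ _)
    (apply_quadraticForm_add Q ψ) (by simp) (eq_zero_of_polarChar_eq_zero Q hψ hQ)

/-- If the composite of `Q` with an additive character is trivial on a subgroup whose order is
the square root of the order of the space, then the Gauss sum is that order. -/
theorem gaussSum_eq_card_of_trivial [Fintype V] (hψ : ψ ≠ 0)
    (hQ : LinearMap.ker Q.polarBilin = ⊥) (W : AddSubgroup V) (hW : ∀ x ∈ W, ψ (Q x) = 1)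
    (hcard : Nat.card W * Nat.card W = Nat.card V) :
    ∑ x, ψ (Q x) = Nat.card W := by
  classical
  have h := card_mul_card_annihilator (polarChar Q ψ) (polarChar_symm Q ψ)
    (eq_zero_of_polarChar_eq_zero Q hψ hQ) W
  rw [← hcard] at h
  have h' := Nat.eq_of_mul_eq_mul_left Nat.card_pos h
  have hsub : ({x | x ∈ W} : Finset V) ⊆
      ({x | ∀ y ∈ W, polarChar Q ψ x y = 1} : Finset V) := by
    intro x hx
    simp only [Finset.mem_filter, Finset.mem_univ, true_and] at hx ⊢
    intro y hy
    have := apply_quadraticForm_add Q ψ x y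
    rwa [hW _ (W.add_mem hx hy), hW x hx, hW y hy, one_mul, one_mul, eq_comm] at this
  have hWcard : Finset.card {x | x ∈ W} = Nat.card W := by
    rw [Nat.card_eq_fintype_card, Fintype.card_subtype]
  have heq := Finset.eq_of_subset_of_card_le hsub (by rw [h', hWcard])
  rw [sum_quadratic_eq_sum_annihilator (fun x ↦ ψ (Q x)) (polarChar Q ψ)
    (apply_quadraticForm_add Q ψ) W hW, ← heq, ← hWcard, Finset.cast_card]
  refine Finset.sum_congr rfl fun x hx ↦ hW x (by simpa using hx)

theorem annihilator_submodule (hψ : ψ ≠ 0) (U : Submodule K V) (x : V) :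
    (∀ y ∈ U.toAddSubgroup, polarChar Q ψ x y = 1) ↔
      ∀ y ∈ U, QuadraticMap.polar Q x y = 0 := by
  refine ⟨fun h y hy ↦ eq_zero_of_forall_addChar_mul hψ fun c ↦ ?_, fun h y hy ↦ ?_⟩
  · simpa [QuadraticMap.polar_smul_right] using h (c • y) (U.smul_mem c hy)
  · rw [polarChar_apply, h y hy, AddChar.map_zero_eq_one]

/-- A maximal totally singular subspace contains all singular vectors orthogonal to it. -/
theorem mem_of_maximal_singular {U : Submodule K V}
    (hU : Maximal (fun U : Submodule K V ↦ ∀ x ∈ U, Q x = 0) U) {x : V} (hx : Q x = 0)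
    (hxU : ∀ y ∈ U, QuadraticMap.polar Q x y = 0) : x ∈ U := by
  have hsing : ∀ y ∈ U ⊔ K ∙ x, Q y = 0 := by
    intro y hy
    obtain ⟨u, hu, v, hv, rfl⟩ := Submodule.mem_sup.1 hy
    obtain ⟨c, rfl⟩ := Submodule.mem_span_singleton.1 hv
    rw [QuadraticMap.map_add Q, QuadraticMap.map_smul, hU.prop u hu, hx,
      QuadraticMap.polar_smul_right, QuadraticMap.polar_comm, hxU u hu]
    simp
  exact hU.le_of_ge hsing le_sup_left
    (Submodule.mem_sup_right (Submodule.mem_span_singleton_self x))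

/-- For a form of minus type no Gauss sum takes the value attained by forms of plus type. -/
theorem gaussSum_ne_of_minus [Fintype K] [Fintype V] (hψ : ψ ≠ 0)
    (hQ : LinearMap.ker Q.polarBilin = ⊥) {m : ℕ} (hm : finrank K V = 2 * m)
    (hminus : ¬ ∃ W : Submodule K V, (∀ x ∈ W, Q x = 0) ∧ finrank K W = m) :
    ∑ x, ψ (Q x) ≠ (Fintype.card K : ℂ) ^ m := by
  classical
  intro hsum
  have : FiniteDimensional K V := Module.Finite.of_finite
  set k := Fintype.card K with hk
  have hk1 : 1 < k := Fintype.one_lt_card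
  obtain ⟨U, hU⟩ := exists_maximal_of_wellFoundedGT
    (fun U : Submodule K V ↦ ∀ x ∈ U, Q x = 0) ⟨⊥, by simp⟩
  set P : Finset V := {x | ∀ y ∈ U, QuadraticMap.polar Q x y = 0} with hP
  set d := finrank K U with hd
  have hUcard : Nat.card U = k ^ d := by
    rw [Nat.card_eq_fintype_card, Module.card_eq_pow_finrank (K := K)]
  have hVcard : Fintype.card V = k ^ (2 * m) := by
    rw [Module.card_eq_pow_finrank (K := K), hm]
  have hmul : k ^ d * P.card = k ^ (2 * m) := by
    have h := card_mul_card_annihilator (polarChar Q ψ) (polarChar_symm Q ψ)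
      (eq_zero_of_polarChar_eq_zero Q hψ hQ) U.toAddSubgroup
    simp only [annihilator_submodule Q hψ U] at h
    rw [← hVcard, ← hUcard, ← Nat.card_eq_fintype_card]
    exact h
  have hUP : ({x | x ∈ U} : Finset V) ⊆ P := by
    intro x hx
    simp only [hP, Finset.mem_filter, Finset.mem_univ, true_and] at hx ⊢
    intro y hy
    simp [QuadraticMap.polar, hU.prop _ (U.add_mem hx hy), hU.prop x hx, hU.prop y hy]
  have hUcard' : Finset.card {x | x ∈ U} = k ^ d := by
    rw [← hUcard, Nat.card_eq_fintype_card, Fintype.card_subtype]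
  have hdm : d < m := by
    refine lt_of_le_of_ne ?_ fun h ↦ hminus ⟨U, hU.prop, h⟩
    have h := Finset.card_le_card hUP
    rw [hUcard'] at h
    have h' : k ^ (d + d) ≤ k ^ (2 * m) := by
      rw [← hmul, pow_add]
      exact Nat.mul_le_mul_left _ h
    have := (Nat.pow_le_pow_iff_right hk1).1 h'
    lia
  have hPcard : k ^ (m + 1) ≤ P.card := by
    have h : k ^ d * P.card = k ^ d * k ^ (2 * m - d) := by
      rw [hmul, ← pow_add]
      congr 1
      lia
    rw [Nat.eq_of_mul_eq_mul_left (by positivity) h]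
    exact Nat.pow_le_pow_right hk1.le (by lia)
  have hUle : k * k ^ d ≤ k ^ m := by
    rw [← pow_succ']
    exact Nat.pow_le_pow_right hk1.le hdm
  have hS (c : K) (hc : c ≠ 0) : ∑ x, ψ (c * Q x) = ∑ x ∈ P, ψ (c * Q x) := by
    have h := sum_quadratic_eq_sum_annihilator (fun x ↦ (ψ.mulShift c) (Q x))
      (polarChar Q (ψ.mulShift c)) (apply_quadraticForm_add Q _) U.toAddSubgroup
      (fun x hx ↦ by simp [hU.prop x hx])
    simpa only [annihilator_submodule Q (mulShift_ne_zero hψ hc) U, AddChar.mulShift_apply] using h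
  have hnorm (c : K) (hc : c ≠ 0) : ‖∑ x, ψ (c * Q x)‖ = (k : ℝ) ^ m := by
    have h := normSq_gaussSum_quadraticForm Q (mulShift_ne_zero hψ hc) hQ
    rw [Complex.normSq_eq_norm_sq, hVcard] at h
    simp only [AddChar.mulShift_apply] at h
    refine (sq_eq_sq₀ (norm_nonneg _) (by positivity)).1 ?_
    rw [h]
    push_cast
    ring
  have htotal : ∑ c, ∑ x ∈ P, ψ (c * Q x) = (k : ℂ) * (k : ℂ) ^ d := by
    rw [Finset.sum_comm, ← Finset.sum_subset hUP]
    · rw [← Nat.cast_pow, ← hUcard', Finset.cast_card, Finset.mul_sum]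
      refine Finset.sum_congr rfl fun x hx ↦ ?_
      simp [hU.prop x (by simpa using hx), hk]
    · intro x hx hxU
      have hne : Q x ≠ 0 := fun h ↦ hxU (by
        simpa using mem_of_maximal_singular Q hU h (by simpa [hP] using hx))
      simp_rw [mul_comm _ (Q x), ← AddChar.mulShift_apply]
      rw [AddChar.sum_eq_ite, if_neg (mulShift_ne_zero hψ hne)]
  have hsplit : ∑ c, ∑ x ∈ P, ψ (c * Q x) =
      P.card + ((k : ℂ) ^ m + ∑ c ∈ (Finset.univ.erase 0).erase 1, ∑ x, ψ (c * Q x)) := by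
    rw [← Finset.add_sum_erase _ _ (Finset.mem_univ (0 : K))]
    congr 1
    · simp
    · rw [← hsum, ← Finset.sum_congr rfl fun c hc ↦ hS c (Finset.ne_of_mem_erase hc),
        ← Finset.add_sum_erase _ _ (show (1 : K) ∈ Finset.univ.erase 0 by simp)]
      simp
  have hbound : ‖∑ c ∈ (Finset.univ.erase (0 : K)).erase 1, ∑ x, ψ (c * Q x)‖ ≤
      ((k : ℝ) - 2) * (k : ℝ) ^ m := by
    refine (norm_sum_le _ _).trans (le_of_eq ?_)
    rw [Finset.sum_congr rfl fun c hc ↦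
      hnorm c (Finset.ne_of_mem_erase (Finset.mem_of_mem_erase hc)), Finset.sum_const,
      Finset.card_erase_of_mem (by simp), Finset.card_erase_of_mem (by simp), Finset.card_univ,
      nsmul_eq_mul, Nat.sub_sub, Nat.cast_sub (by lia), ← hk]
    norm_num
  rw [htotal] at hsplit
  have hre := congrArg Complex.re hsplit
  have hle := (abs_le.1 ((Complex.abs_re_le_norm _).trans hbound)).1
  have e1 : ((k : ℂ) * (k : ℂ) ^ d).re = ((k * k ^ d : ℕ) : ℝ) := by
    rw [← Complex.natCast_re]
    push_cast
    rfl
  have e2 : ((k : ℂ) ^ m).re = ((k ^ m : ℕ) : ℝ) := by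
    rw [← Complex.natCast_re]
    push_cast
    rfl
  rw [Complex.add_re, Complex.add_re, e1, e2, Complex.natCast_re] at hre
  have i1 : ((k * k ^ d : ℕ) : ℝ) ≤ ((k ^ m : ℕ) : ℝ) := Nat.cast_le.2 hUle
  have i2 : ((k ^ (m + 1) : ℕ) : ℝ) ≤ P.card := Nat.cast_le.2 hPcard
  have hpos : (0 : ℝ) < (k : ℝ) ^ m := by positivity
  push_cast at hre i1 i2
  rw [pow_succ] at i2
  nlinarith

end Form


/-- Let `q` be a prime power, `w ≥ 1`, `K = GF(q^w)`, `F = GF(q)`, `V`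
an `A`-dimensional `K`-vector space with `A` even, `Q : V → K` a non-degenerate quadratic
form admitting no totally singular `K`-subspace of dimension `A/2` (i.e. `(V,Q)` is of
type `O⁻`), and `L : K → F` a nonzero `F`-linear map.  Then `LQ = L ∘ Q` is a
non-degenerate quadratic form on the `Aw`-dimensional `F`-vector space `V` admitting no
totally singular `F`-subspace of dimension `Aw/2`; that is, `(V, LQ)` is of type
`O⁻(Aw, q)`. -/
theorem stmt_10 {F K V : Type*} [Field F] [Field K] [Algebra F K]
    [AddCommGroup V] [Module K V] [Module F V] [IsScalarTower F K V]
    [Fintype F] [Fintype K] [FiniteDimensional K V]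
    (q w A : ℕ) (hw : 1 ≤ w)
    (hcardF : Fintype.card F = q) (hcardK : Fintype.card K = q ^ w)
    (hA : Module.finrank K V = A) (hAeven : Even A)
    (Q : QuadraticForm K V)
    (hQnd : ∀ u : V, Q u = 0 → (∀ v : V, QuadraticMap.polar ⇑Q u v = 0) → u = 0)
    (hminus : ¬ ∃ W : Submodule K V, (∀ x ∈ W, Q x = 0) ∧ Module.finrank K W = A / 2)
    (L : K →ₗ[F] F) (hL : L ≠ 0) :
    (∀ u : V, L (Q u) = 0 → (∀ v : V, L (QuadraticMap.polar ⇑Q u v) = 0) → u = 0) ∧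
    Module.finrank F V = A * w ∧
    ¬ ∃ W : Submodule F V, (∀ x ∈ W, L (Q x) = 0) ∧ Module.finrank F W = A * w / 2 := by
  classical
  have hKV : Finite V := Module.finite_of_finite K
  have := Fintype.ofFinite V
  have : FiniteDimensional F K := Module.Finite.of_finite
  have hq : 1 < q := hcardF ▸ Fintype.one_lt_card
  have hFK : Module.finrank F K = w := by
    refine Nat.pow_right_injective hq ?_
    change q ^ _ = q ^ _
    rw [← hcardK, ← hcardF, ← Module.card_eq_pow_finrank]
  have hFV : Module.finrank F V = A * w := by
    rw [← Module.finrank_mul_finrank F K V, hFK, hA, mul_comm]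
  have hker : LinearMap.ker Q.polarBilin = ⊥ := ker_polarBilin_eq_bot (hA ▸ hAeven) Q hQnd
  have hLsurj : Function.Surjective L := LinearMap.surjective hL
  refine ⟨fun u _ hu ↦ ?_, hFV, ?_⟩
  · rw [← Submodule.mem_bot K, ← hker, LinearMap.mem_ker]
    ext v
    by_contra hne
    change QuadraticMap.polar Q u v ≠ 0 at hne
    refine hL (LinearMap.ext fun t ↦ ?_)
    have h := hu ((t / QuadraticMap.polar Q u v) • v)
    rwa [QuadraticMap.polar_smul_right, smul_eq_mul, div_mul_cancel₀ _ hne] at h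
  · rintro ⟨W, hW, hWdim⟩
    obtain ⟨m, rfl⟩ := hAeven
    obtain ⟨χ, hχ⟩ := (AddChar.exists_apply_ne_zero (a := (1 : F))).2 one_ne_zero
    obtain ⟨t, ht⟩ := hLsurj 1
    have hψ : χ.compAddMonoidHom L.toAddMonoidHom ≠ 0 := by
      intro h
      have := DFunLike.congr_fun h t
      exact hχ (by simpa [ht] using this)
    have hcardW : Nat.card W = Fintype.card K ^ m := by
      rw [Nat.card_eq_fintype_card, Module.card_eq_pow_finrank (K := F), hWdim, hcardF, hcardK,
        ← pow_mul]
      congr 1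
      rw [← two_mul, mul_assoc, Nat.mul_div_cancel_left _ two_pos, mul_comm]
    have h := gaussSum_eq_card_of_trivial Q hψ hker W.toAddSubgroup
      (fun x hx ↦ by simp [hW x hx]) (by
        change Nat.card W * Nat.card W = _
        rw [hcardW, Nat.card_eq_fintype_card, Module.card_eq_pow_finrank (K := K) (V := V), hA,
          pow_add])
    refine gaussSum_ne_of_minus Q hψ hker (m := m) (by lia) ?_ (h.trans ?_)
    · convert hminus using 5
      lia
    · change ((Nat.card W : ℕ) : ℂ) = _
      rw [hcardW, Nat.cast_pow]
end

section
/- Let q be an odd prime power, w = 2n even, K = GF(q^w), F = GF(q), V an A-dimensional K-vector space with A odd, and Q : V → K a non-degenerate quadratic form. Suppose V = R ⊥ S is an orthogonal decomposition with respect to the polar form of Q, where Q restricted to R is non-degenerate and admits a totally singular K-subspace of dimension (dim_K R)/2 (an orthogonal sum of hyperbolic lines), and S is a one-dimensional anisotropic subspace (the germ) spanned by a vector s with Q(s) = γ ≠ 0. Let α ∈ K^* and L(x) = Tr_{K/F}(αx). Then LQ = L∘Q is a non-degenerate quadratic form on the Aw-dimensional F-vector space V, and LQ is of type O^+ (admits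 a totally singular F-subspace of dimension Aw/2) if and only if either (αγ)^{-2} lies in GF(q^n) but is not a square in GF(q^n), or N(αγ) = (αγ)^{q^n+1} ≠ −s² for every s ∈ GF(q^n)^*; LQ is of type O^− otherwise. -/
open QuadraticMap (polar polarBilin polar_comm polar_smul_right polar_self)

/-- A totally singular subspace of half the dimension is its own orthogonal complement. -/
theorem mem_of_forall_polar_eq_zero {k M : Type*} [Field k] [AddCommGroup M] [Module k M]
    [FiniteDimensional k M] (f : QuadraticForm k M)
    (hf : ∀ u, (∀ v, polar f u v = 0) → u = 0) (U : Submodule k M)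
    (hU : ∀ u ∈ U, f u = 0) (hdim : Module.finrank k M = 2 * Module.finrank k U)
    {v : M} (hv : ∀ u ∈ U, polar f v u = 0) : v ∈ U := by
  have hsymm : (polarBilin f).IsSymm := ⟨fun x y => by simp [polar_comm]⟩
  have hnd : (polarBilin f).Nondegenerate :=
    LinearMap.IsRefl.nondegenerate_iff_separatingLeft hsymm.isRefl |>.2
      fun u hu => hf u hu
  have hle : U ≤ LinearMap.BilinForm.orthogonal (polarBilin f) U := fun x hx y hy => by
    change polar f y x = 0
    simp [polar, hU _ (U.add_mem hy hx), hU _ hx, hU _ hy]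
  have heq : U = LinearMap.BilinForm.orthogonal (polarBilin f) U :=
    Submodule.eq_of_le_of_finrank_eq hle (by
      rw [LinearMap.BilinForm.finrank_orthogonal hnd]; omega)
  rw [heq]
  intro u hu
  change polar f u v = 0
  rw [polar_comm]
  exact hv u hu

/-- The exponential sum of a non-degenerate quadratic form with a totally singular subspace of half
the dimension is the order of that subspace. -/
theorem sum_addChar_quadraticForm {k M : Type*} [Field k] [AddCommGroup M] [Module k M]
    [Fintype M] (f : QuadraticForm k M)
    (hf : ∀ u, (∀ v, polar f u v = 0) → u = 0) {ψ : AddChar k ℂ} (hψ : ∃ a, ψ a ≠ 1)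
    (U : Submodule k M) (hU : ∀ u ∈ U, f u = 0)
    (hdim : Module.finrank k M = 2 * Module.finrank k U) :
    ∑ v, ψ (f v) = Nat.card U := by
  classical
  obtain ⟨a, ha⟩ := hψ
  have : Module.Finite k M := Module.Finite.of_finite
  have hcard : (Fintype.card U : ℂ) ≠ 0 := Nat.cast_ne_zero.2 Fintype.card_ne_zero
  have hinner (v : M) : ∑ u : U, ψ (polar f v u) = if v ∈ U then (Fintype.card U : ℂ) else 0 := by
    let χ : AddChar U ℂ :=
      ψ.compAddMonoidHom ((polarBilin f v).toAddMonoidHom.comp U.subtype.toAddMonoidHom)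
    have hχ : ∀ u, χ u = ψ (polar f v u) := fun u => rfl
    have hiff : χ = 0 ↔ v ∈ U := by
      constructor
      · intro h
        refine mem_of_forall_polar_eq_zero f hf U hU hdim fun u hu => ?_
        by_contra hne
        apply ha
        have := DFunLike.congr_fun h ((a / polar f v u) • ⟨u, hu⟩ : U)
        rw [hχ] at this
        simpa [polar_smul_right, hne] using this
      · intro h
        ext u
        rw [hχ]
        simp [polar, hU _ (U.add_mem h u.2), hU _ h, hU _ u.2]
    simp only [← hχ, AddChar.sum_eq_ite, hiff]
  have hshift (u : U) : ∑ v, ψ (f v) = ∑ v, ψ (f v) * ψ (polar f v u) := by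
    rw [← Equiv.sum_comp (Equiv.addRight (u : M))]
    refine Finset.sum_congr rfl fun v _ => ?_
    rw [← AddChar.map_add_eq_mul]
    simp [polar, hU _ u.2]
  have key : (Fintype.card U : ℂ) * ∑ v, ψ (f v) = Fintype.card U * Nat.card U := by
    calc (Fintype.card U : ℂ) * ∑ v, ψ (f v) = ∑ u : U, ∑ v, ψ (f v) := by simp
      _ = ∑ u : U, ∑ v, ψ (f v) * ψ (polar f v u) := Finset.sum_congr rfl fun u _ => hshift u
      _ = ∑ v, if v ∈ U then (Fintype.card U : ℂ) else 0 := by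
        rw [Finset.sum_comm]
        refine Finset.sum_congr rfl fun v _ => ?_
        rw [← Finset.mul_sum, hinner]
        split_ifs with h
        · simp [hU v h]
        · simp
      _ = _ := by
        rw [← Finset.sum_filter, Finset.sum_const, nsmul_eq_mul, mul_comm]
        simp [Fintype.card_subtype]
  exact mul_left_cancel₀ hcard key

theorem pow_succ_ne_neg_sq {F K : Type*} [Field F] [Field K] [Algebra F K]
    (σ : K ≃ₐ[F] K) {m : ℕ} (hσ : ∀ x, σ x = x ^ m) {δ : K}
    (h : (δ⁻¹ ^ 2) ^ m = δ⁻¹ ^ 2) (hns : ¬ ∃ t : K, t ^ m = t ∧ t ^ 2 = δ⁻¹ ^ 2) {s : K}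
    (hs : s ^ m = s) : δ ^ (m + 1) ≠ -s ^ 2 := by
  intro hN
  rw [← hσ, map_pow] at h
  have hneg : σ δ⁻¹ = -δ⁻¹ := (sq_eq_sq_iff_eq_or_eq_neg.1 h).resolve_left fun h =>
    hns ⟨δ⁻¹, (hσ _).symm.trans h, rfl⟩
  rw [map_inv₀, ← inv_neg, inv_inj] at hneg
  rw [pow_succ, ← hσ, hneg] at hN
  refine hns ⟨s⁻¹, by rw [inv_pow, hs], ?_⟩
  rw [inv_pow, inv_pow, inv_inj]
  linear_combination hN

section FixedField

variable {F K : Type*} [Field F] [Field K] [Algebra F K] [Fintype K]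

theorem one_lt_of_card_eq_sq {K : Type*} [Field K] [Fintype K] {m : ℕ}
    (hK : Fintype.card K = m ^ 2) : 1 < m := by
  have := Fintype.one_lt_card (α := K)
  by_contra h
  interval_cases m <;> omega

/-- If `x ↦ x ^ m` is an automorphism of the field of order `m ^ 2`, its fixed field has
order `m`. -/
theorem card_fixed (σ : K →ₐ[F] K) {m : ℕ} (hσ : ∀ x, σ x = x ^ m)
    (hK : Fintype.card K = m ^ 2) : Nat.card (AlgHom.equalizer σ (AlgHom.id F K)) = m := by
  have hm : 1 < m := one_lt_of_card_eq_sq hK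
  classical
  obtain ⟨k, rfl⟩ : ∃ k, m = k + 1 := ⟨m - 1, by omega⟩
  have hset : ((AlgHom.equalizer σ (AlgHom.id F K) : Subalgebra F K) : Set K) =
      insert 0 (Units.val '' ((powMonoidHom k : Kˣ →* Kˣ).ker : Set Kˣ)) := by
    ext x
    simp only [SetLike.mem_coe, AlgHom.mem_equalizer, hσ, AlgHom.id_apply, Set.mem_insert_iff,
      Set.mem_image, MonoidHom.mem_ker, powMonoidHom_apply]
    constructor
    · intro h
      refine or_iff_not_imp_left.2 fun hx => ⟨Units.mk0 x hx, Units.ext ?_, rfl⟩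
      rw [pow_succ] at h
      simpa [hx] using h
    · rintro (rfl | ⟨u, hu, rfl⟩)
      · simp
      · rw [← Units.val_pow_eq_pow_val, pow_succ, hu, one_mul]
  have hcard : Nat.card (powMonoidHom k : Kˣ →* Kˣ).ker = k := by
    rw [IsCyclic.card_powMonoidHom_ker, Nat.card_eq_fintype_card, Fintype.card_units, hK]
    exact Nat.gcd_eq_right ⟨k + 2, by
      rw [Nat.sub_eq_iff_eq_add (Nat.one_le_pow _ (k + 1) (by omega))]; ring⟩
  change Nat.card ((AlgHom.equalizer σ (AlgHom.id F K) : Subalgebra F K) : Set K) = k + 1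
  rw [hset, Nat.card_coe_set_eq, Set.ncard_insert_of_notMem (by simp),
    Set.ncard_image_of_injective _ Units.val_injective, ← Nat.card_coe_set_eq]
  exact congrArg (· + 1) hcard

/-- The norm from `GF(m ^ 2)` to `GF(m)` is surjective. -/
theorem exists_pow_succ_eq {m : ℕ} (hK : Fintype.card K = m ^ 2) {e : K}
    (he : e ^ m = e) (he0 : e ≠ 0) : ∃ u : K, u ≠ 0 ∧ u ^ (m + 1) = e := by
  have hm : 1 < m := one_lt_of_card_eq_sq hK
  classical
  obtain ⟨k, rfl⟩ : ∃ k, m = k + 1 := ⟨m - 1, by omega⟩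
  have hsub : (k + 1) ^ 2 - 1 = (k + 2) * k := by
    rw [Nat.sub_eq_iff_eq_add (Nat.one_le_pow _ (k + 1) (by omega))]; ring
  have hle : (powMonoidHom (k + 2) : Kˣ →* Kˣ).range ≤ (powMonoidHom k : Kˣ →* Kˣ).ker := by
    rintro _ ⟨u, rfl⟩
    rw [MonoidHom.mem_ker, powMonoidHom_apply, powMonoidHom_apply, ← pow_mul, ← hsub, ← hK,
      ← Fintype.card_units, pow_card_eq_one]
  have heq := Subgroup.eq_of_le_of_card_ge hle (by
    rw [IsCyclic.card_powMonoidHom_ker, IsCyclic.card_powMonoidHom_range,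
      Nat.card_eq_fintype_card, Fintype.card_units, hK, hsub, Nat.gcd_mul_left_left,
      Nat.gcd_mul_right_left, Nat.mul_div_cancel_left _ (by omega)])
  have hmem : Units.mk0 e he0 ∈ (powMonoidHom k : Kˣ →* Kˣ).ker := by
    refine Units.ext ?_
    rw [pow_succ] at he
    simpa [he0] using he
  rw [← heq] at hmem
  obtain ⟨u, hu⟩ := hmem
  exact ⟨u, u.ne_zero, by simpa using congrArg Units.val hu⟩

/-- An element of `GF(m ^ 2)` whose norm is a square in `GF(m)` is a square. -/
theorem exists_eq_sq_of_pow_succ_eq_sq {m : ℕ} (hm : Odd m) (hK : Fintype.card K = m ^ 2) {z : K}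
    {t : K} (ht : t ^ m = t) (ht0 : t ≠ 0) (hz : z ^ (m + 1) = t ^ 2) : ∃ x, z = x ^ 2 := by
  have hchar : ringChar K ≠ 2 := fun h => by
    have := FiniteField.even_card_of_char_two h
    rw [hK, ← Nat.even_iff] at this
    exact Nat.not_even_iff_odd.2 hm.pow this
  have hz0 : z ≠ 0 := fun h => by
    rw [h, zero_pow (by omega)] at hz
    exact ht0 (by simpa using hz.symm)
  obtain ⟨x, hx⟩ := (FiniteField.isSquare_iff hchar hz0).2 (by
    obtain ⟨j, rfl⟩ := hm
    have : (2 * j + 1) ^ 2 / 2 = (2 * j + 1 + 1) * j := by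
      have : (2 * j + 1) ^ 2 = 2 * ((2 * j + 1 + 1) * j) + 1 := by ring
      omega
    rw [hK, this, pow_mul, hz, ← pow_mul]
    rw [pow_succ] at ht
    simpa [ht0] using ht)
  exact ⟨x, by rw [hx, sq]⟩

theorem exists_map_mul_sq_eq_neg (σ : K ≃ₐ[F] K) {m : ℕ} (hσ : ∀ x, σ x = x ^ m) (hm : Odd m)
    (hK : Fintype.card K = m ^ 2) {δ : K} (hδ0 : δ ≠ 0)
    (hδ : ∀ s : K, s ^ m = s → s ≠ 0 → δ ^ (m + 1) ≠ -s ^ 2) :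
    ∃ x, x ≠ 0 ∧ σ (δ * x ^ 2) = -(δ * x ^ 2) := by
  have hσσ (x : K) : σ (σ x) = x := by
    rw [hσ, hσ, ← pow_mul, ← sq, ← hK, FiniteField.pow_card]
  have hN : σ (δ ^ (m + 1)) = δ ^ (m + 1) := by
    rw [pow_succ, ← hσ, map_mul, hσσ, mul_comm]
  have hN0 : δ ^ (m + 1) ≠ 0 := pow_ne_zero _ hδ0
  obtain ⟨y, hy⟩ : ∃ y, -δ ^ (m + 1) = y ^ 2 := by
    refine exists_eq_sq_of_pow_succ_eq_sq hm hK (t := δ ^ (m + 1)) ((hσ _).symm.trans hN) hN0 ?_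
    rw [pow_succ, ← hσ, map_neg, hN]
    ring
  have hy0 : y ≠ 0 := fun h => hN0 (by simpa [h] using hy)
  have hσy : σ y = -y := by
    have h : σ y ^ 2 = y ^ 2 := by rw [← map_pow, ← hy, map_neg, hN]
    refine (sq_eq_sq_iff_eq_or_eq_neg.1 h).resolve_left fun h => ?_
    exact hδ y ((hσ y).symm.trans h) hy0 (by rw [← hy, neg_neg])
  obtain ⟨x, hx⟩ : ∃ x, y / δ = x ^ 2 := by
    refine exists_eq_sq_of_pow_succ_eq_sq hm hK (one_pow m) one_ne_zero ?_
    rw [div_pow, pow_succ y, ← hσ, hσy, one_pow, div_eq_one_iff_eq hN0]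
    linear_combination hy
  have hyx : δ * x ^ 2 = y := by rw [← hx, mul_div_cancel₀ _ hδ0]
  refine ⟨x, fun h => hy0 (by rw [← hyx, h]; ring), by rw [hyx, hσy]⟩

variable [Fintype F]

theorem sum_addChar_trace_norm (σ : K ≃ₐ[F] K) {m : ℕ} (hσ : ∀ x, σ x = x ^ m)
    (hK : Fintype.card K = m ^ 2) (h2 : (2 : F) ≠ 0) {ψ : AddChar F ℂ} (hψ : ∃ a, ψ a ≠ 1)
    {c : K} (hc : σ c = c) (hc0 : c ≠ 0) :
    ∑ x : K, ψ (Algebra.trace F K (c * x ^ (m + 1))) = -m := by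
  classical
  obtain ⟨a, ha⟩ := hψ
  have hm : 1 < m := one_lt_of_card_eq_sq hK
  have hσσ (x : K) : σ (σ x) = x := by
    rw [hσ, hσ, ← pow_mul, ← sq, ← hK, FiniteField.pow_card]
  have htr (x : K) : Algebra.trace F K (σ x) = Algebra.trace F K x :=
    Algebra.trace_eq_of_algEquiv σ x
  let E := AlgHom.equalizer (σ : K →ₐ[F] K) (AlgHom.id F K)
  have hE : ∀ x, x ∈ E ↔ σ x = x := fun x => Iff.rfl
  have hcardE : Nat.card E = m := card_fixed (σ : K →ₐ[F] K) hσ hK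
  obtain ⟨z, hz⟩ := Algebra.trace_surjective F K (a / 2)
  have hinner (x : K) : ∑ e : E, ψ (Algebra.trace F K (c * (e * x ^ (m + 1)))) =
      if x = 0 then (m : ℂ) else 0 := by
    split_ifs with hx
    · simp [hx, ← Nat.card_eq_fintype_card, hcardE]
    · have hd : c * x ^ (m + 1) ≠ 0 := mul_ne_zero hc0 (pow_ne_zero _ hx)
      have hσd : σ (c * x ^ (m + 1)) = c * x ^ (m + 1) := by
        rw [pow_succ, ← hσ, map_mul, map_mul, hσσ, hc]; ring
      let χ : AddChar E ℂ := ψ.compAddMonoidHom ((Algebra.trace F K).toAddMonoidHom.comp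
        ((AddMonoidHom.mulRight (c * x ^ (m + 1))).comp E.val.toLinearMap.toAddMonoidHom))
      have hχ (e : E) : χ e = ψ (Algebra.trace F K (c * (e * x ^ (m + 1)))) := by
        change ψ (Algebra.trace F K (e * (c * x ^ (m + 1)))) = _
        congr 2; ring
      have hne : χ ≠ 0 := fun h => by
        have hmem : (z + σ z) / (c * x ^ (m + 1)) ∈ E := by
          rw [hE, map_div₀, hσd, map_add, hσσ, add_comm]
        have := DFunLike.congr_fun h ⟨_, hmem⟩
        change ψ (Algebra.trace F K ((z + σ z) / (c * x ^ (m + 1)) * (c * x ^ (m + 1)))) = 1 at this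
        rw [div_mul_cancel₀ _ hd, map_add, htr, hz, ← two_mul,
          mul_div_cancel₀ _ h2] at this
        exact ha this
      simp only [← hχ, AddChar.sum_eq_ite, hne, if_false]
  have houter (e : E) : ∑ x : K, ψ (Algebra.trace F K (c * (e * x ^ (m + 1)))) =
      if e = 0 then (m : ℂ) ^ 2 else ∑ x : K, ψ (Algebra.trace F K (c * x ^ (m + 1))) := by
    split_ifs with he
    · simp [he, hK]
    · obtain ⟨u, hu0, hu⟩ := exists_pow_succ_eq hK (e := (e : K))
        ((hσ _).symm.trans e.2) (by simpa using he)
      rw [← Equiv.sum_comp (Equiv.mulLeft₀ u hu0)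
        fun x => ψ (Algebra.trace F K (c * x ^ (m + 1)))]
      simp [mul_pow, hu]
  have key : (m : ℂ) ^ 2 + (m - 1) * ∑ x : K, ψ (Algebra.trace F K (c * x ^ (m + 1))) = m := by
    have h := Finset.sum_comm (s := (Finset.univ : Finset E)) (t := (Finset.univ : Finset K))
      (f := fun e x => ψ (Algebra.trace F K (c * (e * x ^ (m + 1)))))
    simp only [hinner, houter, Finset.sum_ite_eq', Finset.mem_univ, if_true] at h
    rw [← Finset.add_sum_erase _ _ (Finset.mem_univ (0 : E)), if_pos rfl,
      Finset.sum_congr rfl (fun e he => if_neg (Finset.ne_of_mem_erase he)),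
      Finset.sum_const, Finset.card_erase_of_mem (Finset.mem_univ _), Finset.card_univ,
      ← Nat.card_eq_fintype_card, hcardE, nsmul_eq_mul, Nat.cast_pred (by omega)] at h
    simpa using h
  have hm1 : (m : ℂ) - 1 ≠ 0 := sub_ne_zero.2 (by exact_mod_cast hm.ne')
  apply mul_left_cancel₀ hm1
  linear_combination key

/-- The substitution `x ↦ x + (σ δ / s) σ x` turns `Tr (δ x ^ 2)` into `Tr (-2 s N(x))`. -/
theorem sum_addChar_trace_mul_sq (σ : K ≃ₐ[F] K) {m : ℕ} (hσ : ∀ x, σ x = x ^ m)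
    (hK : Fintype.card K = m ^ 2) (h2 : (2 : F) ≠ 0) {ψ : AddChar F ℂ} (hψ : ∃ a, ψ a ≠ 1)
    {δ s : K} (hs : σ s = s) (hs0 : s ≠ 0) (hδ : δ ^ (m + 1) = -s ^ 2) :
    ∑ x : K, ψ (Algebra.trace F K (δ * x ^ 2)) = -m := by
  have h2K : (2 : K) ≠ 0 := by
    rw [← map_ofNat (algebraMap F K) 2]
    exact (map_ne_zero (algebraMap F K)).2 h2
  have hσσ (x : K) : σ (σ x) = x := by
    rw [hσ, hσ, ← pow_mul, ← sq, ← hK, FiniteField.pow_card]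
  have htr (x : K) : Algebra.trace F K (σ x) = Algebra.trace F K x :=
    Algebra.trace_eq_of_algEquiv σ x
  have hδσ : σ δ * δ = -s ^ 2 := by rw [hσ, ← pow_succ, hδ]
  let T : K →+ K := AddMonoidHom.id K +
    (AddMonoidHom.mulLeft (σ δ / s)).comp (σ : K →+ K)
  have hT (x : K) : T x = x + σ δ / s * σ x := rfl
  have hval (x : K) : δ * T x ^ 2 = (δ * x ^ 2 - σ (δ * x ^ 2)) + -2 * s * x ^ (m + 1) := by
    rw [hT, map_mul, map_pow, pow_succ x m, ← hσ]
    field_simp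
    linear_combination (2 * s * x * σ x + σ δ * σ x ^ 2) * hδσ
  have htrT (x : K) : Algebra.trace F K (δ * T x ^ 2) =
      Algebra.trace F K (-2 * s * x ^ (m + 1)) := by
    rw [hval, map_add, map_sub, htr, sub_self, zero_add]
  have hTinj : Function.Injective T := by
    rw [injective_iff_map_eq_zero]
    intro x hx
    by_contra hx0
    have h := hval x
    have h' := congrArg σ h
    rw [hx] at h h'
    simp only [map_add, map_sub, hσσ, map_mul, map_neg, map_ofNat, hs, map_pow, ← hσ,
      map_zero, ne_eq, OfNat.ofNat_ne_zero, not_false_eq_true, zero_pow, mul_zero,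
      pow_succ x m] at h h'
    have : 4 * s * (x * σ x) = 0 := by linear_combination h + h'
    have h4 : (4 : K) ≠ 0 := by
      convert mul_ne_zero h2K h2K using 1; norm_num
    simp [h4, hs0, hx0] at this
  have hTbij : Function.Bijective T := Finite.injective_iff_bijective.1 hTinj
  rw [← hTbij.sum_comp (fun x => ψ (Algebra.trace F K (δ * x ^ 2)))]
  simp only [htrT]
  exact sum_addChar_trace_norm σ hσ hK h2 hψ (by rw [map_mul, hs, map_neg, map_ofNat])
    (by simp [h2K, hs0])

end FixedField

theorem trace_mul_polar_nondegenerate {F K V : Type*} [Field F] [Field K] [Algebra F K]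
    [FiniteDimensional F K] [Algebra.IsSeparable F K] [AddCommGroup V] [Module K V]
    (Q : QuadraticForm K V) (h2 : (2 : K) ≠ 0)
    (hQ : ∀ u : V, Q u = 0 → (∀ v : V, polar Q u v = 0) → u = 0) {α : K} (hα : α ≠ 0) {u : V}
    (hu : ∀ v, Algebra.trace F K (α * polar Q u v) = 0) : u = 0 := by
  have hpolar (v : V) : polar Q u v = 0 := by
    have h : α * polar Q u v = 0 := (traceForm_nondegenerate F K).1 _ fun c => by
      rw [Algebra.traceForm_apply, mul_assoc, mul_comm _ c, ← smul_eq_mul c,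
        ← polar_smul_right, hu]
    exact (mul_eq_zero.1 h).resolve_left hα
  refine hQ u ?_ hpolar
  have h := hpolar u
  rw [polar_self, nsmul_eq_mul, Nat.cast_ofNat] at h
  exact (mul_eq_zero.1 h).resolve_left h2

theorem sum_comp_quadraticForm_orthogonal {K V : Type*} [Field K] [Fintype K] [AddCommGroup V]
    [Module K V] [Fintype V] (Q : QuadraticForm K V) (R : Submodule K V) [Fintype R] {s₀ : V}
    (hs₀ : s₀ ≠ 0) (hR : IsCompl R (Submodule.span K {s₀}))
    (horth : ∀ r ∈ R, polar Q r s₀ = 0) (χ : AddChar K ℂ) :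
    ∑ v, χ (Q v) = (∑ r : R, χ (Q r)) * ∑ x : K, χ (Q s₀ * x ^ 2) := by
  let g : R × K → V := fun p => p.1 + p.2 • s₀
  have hg : Function.Bijective g := by
    constructor
    · rintro ⟨r, x⟩ ⟨r', x'⟩ h
      have h1 : (r - r' : V) = (x' - x) • s₀ := by
        rw [sub_smul, sub_eq_sub_iff_add_eq_add, add_comm (x' • s₀)]
        exact h
      have h2 : (r - r' : V) = 0 := Submodule.disjoint_def.1 hR.disjoint _ (sub_mem r.2 r'.2)
        (h1 ▸ Submodule.smul_mem _ _ (Submodule.mem_span_singleton_self s₀))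
      rw [h2, eq_comm, smul_eq_zero, or_iff_left hs₀] at h1
      exact Prod.ext (Subtype.ext (sub_eq_zero.1 h2)) (sub_eq_zero.1 h1).symm
    · intro v
      obtain ⟨r, hr, y, hy, rfl⟩ := Submodule.mem_sup.1 (hR.sup_eq_top ▸ Submodule.mem_top (x := v))
      obtain ⟨x, rfl⟩ := Submodule.mem_span_singleton.1 hy
      exact ⟨(⟨r, hr⟩, x), rfl⟩
  rw [← hg.sum_comp fun v => χ (Q v), Fintype.sum_prod_type, Finset.sum_mul_sum]
  refine Finset.sum_congr rfl fun r _ => Finset.sum_congr rfl fun x _ => ?_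
  rw [← AddChar.map_add_eq_mul, QuadraticMap.map_add Q, polar_smul_right, horth r r.2,
    QuadraticMap.map_smul Q]
  congr 1
  simp only [smul_eq_mul]
  ring


/-- The `GF(q)`-linear map `L : GF(q^w) → GF(q)`, `L(x) = Tr_{GF(q^w)/GF(q)}(αx)
= Σ_{i=0}^{w-1} (αx)^{q^i}`, with values taken in `K = GF(q^w)` (the trace lands in the
copy of `GF(q)` inside `K`). -/
def traceMul {K : Type*} [Field K] (q w : ℕ) (α : K) : K → K :=
  fun x => ∑ i ∈ Finset.range w, (α * x) ^ q ^ i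

/-- Let `q` be an odd prime power, `w = 2n` even, `K = GF(q^w)`,
`F = GF(q)`, `V` an `A`-dimensional `K`-vector space with `A` odd, and `Q : V → K` a
non-degenerate quadratic form.  Suppose `V = R ⊥ S` is an orthogonal decomposition with
respect to the polar form of `Q`, where `Q` restricted to `R` is non-degenerate and
admits a totally singular `K`-subspace of dimension `(dim_K R)/2` (an orthogonal sum of
hyperbolic lines), and `S` is a one-dimensional anisotropic subspace (the germ) spanned
by a vector `s₀` with `Q(s₀) = γ ≠ 0`.  Let `α ∈ K*` and `L(x) = Tr_{K/F}(αx)`.  Then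
`LQ = L ∘ Q` is a non-degenerate quadratic form on the `Aw`-dimensional `F`-vector space
`V`, and `LQ` is of type `O⁺` (admits a totally singular `F`-subspace of dimension
`Aw/2`) if and only if either `(αγ)⁻²` lies in `GF(q^n)` but is not a square in
`GF(q^n)`, or `N(αγ) = (αγ)^{q^n+1} ≠ −s²` for every `s ∈ GF(q^n)*`; and `LQ` is of type
`O⁻` otherwise.  (Here `GF(q^n)` is realised inside `K` as the set of elements fixed by
`x ↦ x^{q^n}`.) -/
theorem stmt_13 {F K V : Type*} [Field F] [Field K] [Algebra F K]
    [AddCommGroup V] [Module K V] [Module F V] [IsScalarTower F K V]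
    [Fintype F] [Fintype K] [FiniteDimensional K V]
    (q n w A : ℕ) (hq : Odd q) (hw : w = 2 * n) (hn : 0 < n)
    (hcardF : Fintype.card F = q) (hcardK : Fintype.card K = q ^ w)
    (hA : Module.finrank K V = A) (hAodd : Odd A)
    (Q : QuadraticForm K V)
    (hQnd : ∀ u : V, Q u = 0 → (∀ v : V, QuadraticMap.polar ⇑Q u v = 0) → u = 0)
    (R S : Submodule K V) (hsup : R ⊔ S = ⊤) (hinf : R ⊓ S = ⊥)
    (horth : ∀ r ∈ R, ∀ s ∈ S, QuadraticMap.polar ⇑Q r s = 0)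
    (hRnd : ∀ u ∈ R, Q u = 0 → (∀ v ∈ R, QuadraticMap.polar ⇑Q u v = 0) → u = 0)
    (hRplus : ∃ W : Submodule K V, W ≤ R ∧ (∀ x ∈ W, Q x = 0) ∧
      Module.finrank K W = Module.finrank K R / 2)
    (s₀ : V) (hS : S = Submodule.span K {s₀})
    (hSaniso : ∀ x ∈ S, x ≠ 0 → Q x ≠ 0)
    (γ : K) (hγ : Q s₀ = γ) (hγ0 : γ ≠ 0)
    (α : K) (hα : α ≠ 0) :
    (∀ u : V, traceMul q w α (Q u) = 0 →
        (∀ v : V, traceMul q w α (QuadraticMap.polar ⇑Q u v) = 0) → u = 0) ∧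
    Module.finrank F V = A * w ∧
    ((∃ W : Submodule F V, (∀ x ∈ W, traceMul q w α (Q x) = 0) ∧
        Module.finrank F W = A * w / 2) ↔
      ((((α * γ)⁻¹ ^ 2) ^ q ^ n = (α * γ)⁻¹ ^ 2 ∧
          ¬ ∃ t : K, t ^ q ^ n = t ∧ t ^ 2 = (α * γ)⁻¹ ^ 2) ∨
        ∀ s : K, s ^ q ^ n = s → s ≠ 0 → (α * γ) ^ (q ^ n + 1) ≠ -s ^ 2)) := by
  classical
  subst hw hcardF hS hγ hA
  set q := Fintype.card F with hqF
  set m := q ^ n with hmdef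
  have hKm : Fintype.card K = m ^ 2 := by rw [hcardK, hmdef, ← pow_mul, mul_comm]
  have hm : Odd m := hq.pow
  have h2F : (2 : F) ≠ 0 := Ring.two_ne_zero fun h => by
    have := FiniteField.even_card_of_char_two h
    rw [← Nat.even_iff] at this
    exact Nat.not_even_iff_odd.2 hq this
  have h2K : (2 : K) ≠ 0 := by
    rw [← map_ofNat (algebraMap F K) 2]
    exact (map_ne_zero (algebraMap F K)).2 h2F
  have hfinK : Module.finrank F K = 2 * n :=
    Nat.pow_right_injective (Fintype.one_lt_card (α := F))
      ((Module.card_eq_pow_finrank (K := F) (V := K)).symm.trans hcardK)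
  have hfinV : Module.finrank F V = Module.finrank K V * (2 * n) := by
    rw [← Module.finrank_mul_finrank F K V, hfinK, mul_comm]
  have : Module.Finite F V := Module.Finite.trans K V
  have : Finite V := Module.finite_of_finite K
  have : Fintype V := Fintype.ofFinite V
  let σ : K ≃ₐ[F] K := FiniteField.frobeniusAlgEquivOfAlgebraic F K ^ n
  have hσ (x : K) : σ x = x ^ m := by
    rw [AlgEquiv.coe_pow, FiniteField.coe_frobeniusAlgEquivOfAlgebraic_iterate]
  have htm (x : K) : traceMul q (2 * n) α x = algebraMap F K (Algebra.trace F K (α * x)) := by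
    rw [FiniteField.algebraMap_trace_eq_sum_pow, hfinK, Nat.card_eq_fintype_card]
    rfl
  have htm0 (x : K) : traceMul q (2 * n) α x = 0 ↔ Algebra.trace F K (α * x) = 0 := by
    rw [htm, map_eq_zero]
  have hnd (u : V) (hu : ∀ v, Algebra.trace F K (α * polar Q u v) = 0) : u = 0 :=
    trace_mul_polar_nondegenerate Q h2K hQnd hα hu
  let f : QuadraticForm F V :=
    ((Algebra.trace F K).comp (LinearMap.mulLeft F α)).compQuadraticMap' Q
  have hf (v : V) : f v = Algebra.trace F K (α * Q v) := rfl
  have hs₀ : s₀ ≠ 0 := by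
    rintro rfl
    exact hγ0 Q.map_zero
  have hcompl : IsCompl R (Submodule.span K {s₀}) := IsCompl.of_eq hinf hsup
  have horth₀ (r : V) (hr : r ∈ R) : polar Q r s₀ = 0 :=
    horth r hr s₀ (Submodule.mem_span_singleton_self s₀)
  have hfinR : Module.finrank K R + 1 = Module.finrank K V := by
    rw [← Submodule.finrank_add_eq_of_isCompl hcompl, finrank_span_singleton hs₀]
  obtain ⟨W, hWR, hWQ, hWdim⟩ := hRplus
  have hWdim2 : Module.finrank K R = 2 * Module.finrank K W := by
    obtain ⟨k, hk⟩ := hAodd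
    omega
  have hAdim : Module.finrank K V * (2 * n) / 2 = 2 * n * Module.finrank K W + n := by
    rw [← hfinR, hWdim2, mul_left_comm, Nat.mul_div_cancel_left _ two_pos]
    ring
  refine ⟨fun u _ hu => hnd u fun v => (htm0 _).1 (hu v), hfinV, ?_, ?_⟩
  · rintro ⟨U, hU, hUdim⟩
    right
    intro s hs hs0 hN
    obtain ⟨ψ, hψ⟩ := AddChar.exists_apply_ne_zero.2 (one_ne_zero (α := F))
    let χ : AddChar K ℂ := ψ.compAddMonoidHom
      ((Algebra.trace F K).toAddMonoidHom.comp (AddMonoidHom.mulLeft α))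
    have hχ (x : K) : χ x = ψ (Algebra.trace F K (α * x)) := rfl
    have hχ1 : ∃ a, χ a ≠ 1 := by
      obtain ⟨z, hz⟩ := Algebra.trace_surjective F K 1
      exact ⟨z / α, by rwa [hχ, mul_div_cancel₀ _ hα, hz]⟩
    have hsumV := sum_addChar_quadraticForm f
      (fun u hu => hnd u fun v => by
        rw [← hu v, LinearMap.compQuadraticMap_polar]; rfl)
      ⟨1, hψ⟩ U (fun u hu => (htm0 _).1 (hU u hu))
      (by rw [hfinV, hUdim, hAdim, ← hfinR, hWdim2]; ring)
    have hWcomap : Module.finrank K (W.comap R.subtype) = Module.finrank K W :=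
      (Submodule.comapSubtypeEquivOfLe hWR).finrank_eq
    have hsumR := sum_addChar_quadraticForm (Q.comp R.subtype)
      (fun u hu => Subtype.ext (hRnd u u.2
        (by simpa [polar_self, h2K] using hu u)
        fun v hv => hu ⟨v, hv⟩)) hχ1 (W.comap R.subtype) (fun u hu => hWQ u hu)
      (by rw [hWcomap, hWdim2])
    have hsplit := sum_comp_quadraticForm_orthogonal Q R hs₀ hcompl horth₀ χ
    have hsumS : ∑ x : K, χ (Q s₀ * x ^ 2) = -m := by
      simp only [hχ, ← mul_assoc]
      exact sum_addChar_trace_mul_sq σ hσ hKm h2F ⟨1, hψ⟩ ((hσ s).trans hs) hs0 hN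
    change ∑ v, χ (Q v) = _ at hsumV
    change ∑ r : R, χ (Q r) = _ at hsumR
    rw [hsumV, hsumR, hsumS] at hsplit
    have hpos : (0 : ℝ) < Nat.card U := Nat.cast_pos.2 Nat.card_pos
    have hsplit' : (Nat.card U : ℝ) = Nat.card (W.comap R.subtype) * -m := by
      exact_mod_cast hsplit
    have : (0 : ℝ) ≤ Nat.card (W.comap R.subtype) * m := by positivity
    linarith
  · intro h
    have hδ : ∀ s : K, s ^ m = s → s ≠ 0 → (α * Q s₀) ^ (m + 1) ≠ -s ^ 2 := by
      rcases h with ⟨h, hns⟩ | h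
      · exact fun s hs _ => pow_succ_ne_neg_sq σ hσ h hns hs
      · exact h
    obtain ⟨x, hx0, hx⟩ := exists_map_mul_sq_eq_neg σ hσ hm hKm (mul_ne_zero hα hγ0) hδ
    let E := AlgHom.equalizer (σ : K →ₐ[F] K) (AlgHom.id F K)
    have hE (e : E) : σ e = e := e.2
    have hEdim : Module.finrank F E = n := by
      have hcard : Nat.card E = m := card_fixed (σ : K →ₐ[F] K) hσ hKm
      rw [Module.natCard_eq_pow_finrank (K := F), Nat.card_eq_fintype_card] at hcard
      exact Nat.pow_right_injective (Fintype.one_lt_card (α := F)) hcard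
    let g : (W × E) →ₗ[F] V := (W.subtype.restrictScalars F).coprod
      (((LinearMap.toSpanSingleton K V (x • s₀)).restrictScalars F).comp E.val.toLinearMap)
    have hg (p : W × E) : g p = p.1 + (p.2 : K) • x • s₀ := rfl
    have hginj : Function.Injective g := by
      rw [injective_iff_map_eq_zero]
      rintro ⟨r, e⟩ h
      rw [hg, smul_smul] at h
      have hr : (r : V) = 0 := Submodule.disjoint_def.1 hcompl.disjoint _ (hWR r.2)
        (eq_neg_of_add_eq_zero_left h ▸ Submodule.neg_mem _
          (Submodule.smul_mem _ _ (Submodule.mem_span_singleton_self s₀)))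
      simp only [hr, zero_add, smul_eq_zero, mul_eq_zero, hx0, hs₀, or_false] at h
      exact Prod.ext (Subtype.ext hr) (Subtype.ext h)
    refine ⟨LinearMap.range g, ?_, ?_⟩
    · rintro _ ⟨⟨r, e⟩, rfl⟩
      have hQ : α * Q (g (r, e)) = e ^ 2 * (α * Q s₀ * x ^ 2) := by
        rw [hg, QuadraticMap.map_add Q, hWQ r r.2, polar_smul_right, polar_smul_right,
          horth₀ r (hWR r.2), QuadraticMap.map_smul Q, QuadraticMap.map_smul Q]
        simp only [smul_eq_mul]
        ring
      have hneg : σ (α * Q (g (r, e))) = -(α * Q (g (r, e))) := by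
        rw [hQ, map_mul, map_pow, hE, hx, mul_neg]
      have htr := Algebra.trace_eq_of_algEquiv σ (α * Q (g (r, e)))
      rw [hneg, map_neg] at htr
      rw [htm0]
      have : 2 * Algebra.trace F K (α * Q (g (r, e))) = 0 := by linear_combination -htr
      exact (mul_eq_zero.1 this).resolve_left h2F
    · rw [LinearMap.finrank_range_of_inj hginj, Module.finrank_prod, hEdim, hAdim,
        ← Module.finrank_mul_finrank F K W, hfinK]
end

section
/- Let q be an odd prime power, w even, K = GF(q^w), and σ(x) = x^{q^{w/2}} the order-2 automorphism of K. Let V be an A-dimensional K-vector space, β : V×V → K a non-degenerate hermitian form with respect to σ, and α ∈ K^* with σ(α) = α; set L(x) = Tr_{K/GF(q)}(αx). Then Lβ = L∘β is a non-degenerate symmetric GF(q)-bilinear form on the Aw-dimensional GF(q)-vector space V, and Lβ admits a totally isotropic GF(q)-subspace of dimension Aw/2 if and only if A is even; that is, (V,Lβ) is of type O^+(Aw,q) if A is even and of type O^−(Aw,q) if A is odd. -/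
open Module

section Isotropic

variable {K V : Type*} [Field K] [AddCommGroup V] [Module K V] [FiniteDimensional K V]
  {σ : K →+* K} (β : V →ₗ[K] V →ₛₗ[σ] K)

/-- The left orthogonal complement of `W` has codimension at most `finrank W`, so it is not
contained in any `U` with `finrank W + finrank U < finrank V`. -/
theorem exists_orthogonal_notMem (W U : Submodule K V)
    (h : finrank K W + finrank K U < finrank K V) :
    ∃ x, x ∉ U ∧ ∀ y ∈ W, β x y = 0 := by
  let b := finBasis K W
  let f : V →ₗ[K] (Fin (finrank K W) → K) :=
    { toFun := fun x i => β x (b i)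
      map_add' := fun x y => by ext i; simp
      map_smul' := fun a x => by ext i; simp }
  have hf : ¬ LinearMap.ker f ≤ U := fun hle => by
    have h₁ := f.finrank_range_add_finrank_ker
    have h₂ := Submodule.finrank_le (LinearMap.range f)
    have h₃ := Submodule.finrank_mono hle
    rw [finrank_fin_fun] at h₂
    omega
  obtain ⟨x, hx, hxU⟩ := SetLike.not_le_iff_exists.mp hf
  refine ⟨x, hxU, fun y hy => ?_⟩
  have hb : ∀ i, β x (b i) = 0 := fun i => congrFun (LinearMap.mem_ker.mp hx) i
  have hsum : ∑ i, b.repr ⟨y, hy⟩ i • (b i : V) = y := by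
    simpa only [map_sum, map_smul, Submodule.subtype_apply] using
      congrArg W.subtype (b.sum_repr ⟨y, hy⟩)
  rw [← hsum]
  simp [hb]

/-- Over a field in which every element fixed by `σ` is a norm `t * σ t`, a hermitian form has
totally isotropic subspaces of every dimension up to half the dimension of the space. -/
theorem exists_isotropic_of_norm_surjective (herm : ∀ v w, β w v = σ (β v w))
    (hnorm : ∀ s, σ s = s → ∃ t, t * σ t = s) (d : ℕ) (hd : 2 * d ≤ finrank K V) :
    ∃ W : Submodule K V, (∀ x ∈ W, ∀ y ∈ W, β x y = 0) ∧ finrank K W = d := by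
  induction d with
  | zero => exact ⟨⊥, by simp, by simp⟩
  | succ d ih =>
    obtain ⟨W, hW, hWd⟩ := ih (by omega)
    suffices ∃ v, v ∉ W ∧ (∀ y ∈ W, β v y = 0) ∧ β v v = 0 by
      obtain ⟨v, hvW, hv, hvv⟩ := this
      have hv' : ∀ y ∈ W, β y v = 0 := fun y hy => by rw [herm v y, hv y hy, map_zero]
      refine ⟨W ⊔ K ∙ v, ?_, by rw [Submodule.finrank_sup_span_singleton hvW, hWd]⟩
      intro _ hxv _ hyv
      obtain ⟨x, hx, _, hx', rfl⟩ := Submodule.mem_sup.mp hxv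
      obtain ⟨y, hy, _, hy', rfl⟩ := Submodule.mem_sup.mp hyv
      obtain ⟨a, rfl⟩ := Submodule.mem_span_singleton.mp hx'
      obtain ⟨b, rfl⟩ := Submodule.mem_span_singleton.mp hy'
      simp [hW x hx y hy, hv y hy, hv' x hx, hvv]
    obtain ⟨x, hxW, hx⟩ := exists_orthogonal_notMem β W W (by omega)
    by_cases hxx : β x x = 0
    · exact ⟨x, hxW, hx, hxx⟩
    obtain ⟨y, hyU, hy⟩ := exists_orthogonal_notMem β W (W ⊔ K ∙ x)
      (by rw [Submodule.finrank_sup_span_singleton hxW]; omega)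
    let c := β y x / β x x
    let z := y - c • x
    have hzx : β z x = 0 := by simp [z, c, hxx]
    have hxz : β x z = 0 := by rw [herm z x, hzx, map_zero]
    obtain ⟨t, ht⟩ := hnorm (-(β z z / β x x)) (by
      rw [map_neg, map_div₀, ← herm, ← herm])
    refine ⟨t • x + z, fun hmem => hyU ?_, fun w hw => by simp [z, hx w hw, hy w hw], ?_⟩
    · have : y = (t • x + z) + (c - t) • x := by simp only [z, sub_smul]; abel
      rw [this]
      exact Submodule.add_mem_sup hmem (Submodule.smul_mem _ _ (Submodule.mem_span_singleton_self x))
    · have : β (t • x + z) (t • x + z) = t * σ t * β x x + β z z := by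
        simp [hzx, hxz]; ring
      rw [this, ht]
      field_simp
      ring

end Isotropic

/-- If a symmetric non-degenerate form on a `2k`-dimensional space over a finite field of odd
characteristic has a totally isotropic subspace `W` of dimension `k`, then the vectors of norm `0`
outnumber those of norm `c ≠ 0` by exactly `|W|`. -/
theorem card_norm_eq_zero_of_isotropic {F V : Type*} [Field F] [AddCommGroup V] [Module F V]
    [Finite V] [FiniteDimensional F V] (h2 : (2 : F) ≠ 0) (B : LinearMap.BilinForm F V)
    (hB : B.Nondegenerate) (hsymm : ∀ x y, B x y = B y x) (W : Submodule F V)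
    (hW : ∀ x ∈ W, ∀ y ∈ W, B x y = 0) (hdim : finrank F V = 2 * finrank F W)
    {c : F} (hc : c ≠ 0) :
    Nat.card {v // B v v = 0} = Nat.card {v // B v v = c} + Nat.card W := by
  classical
  have := Fintype.ofFinite V
  have horth : B.orthogonal W = W := by
    have hle : W ≤ B.orthogonal W := fun x hx y hy => hW y hy x hx
    refine (Submodule.eq_of_le_of_finrank_eq hle ?_).symm
    rw [LinearMap.BilinForm.finrank_orthogonal hB]
    omega
  have hexp : ∀ (v : V) (w : W), B (v + w) (v + w) = B v v + 2 * B v w := fun v w => by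
    simp only [map_add, LinearMap.add_apply, hW w w.2 w w.2, hsymm w v]
    ring
  let ind : F → V → ℕ := fun a v => if B v v = a then 1 else 0
  have hshift : ∀ a, Fintype.card W * ∑ v, ind a v = ∑ v, ∑ w : W, ind a (v + w) := fun a => by
    rw [Finset.sum_comm, ← Finset.card_univ, ← smul_eq_mul, ← Finset.sum_const]
    exact Finset.sum_congr rfl fun w _ =>
      (Fintype.sum_equiv (Equiv.addRight (w : V)) _ _ fun v => rfl).symm
  have hcoset : ∀ v, ∑ w : W, ind 0 (v + w) =
      ∑ w : W, ind c (v + w) + if v ∈ W then Fintype.card W else 0 := fun v => by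
    by_cases hv : v ∈ W
    · have : ∀ w : W, B (v + w) (v + w) = 0 := fun w =>
        hW _ (W.add_mem hv w.2) _ (W.add_mem hv w.2)
      simp only [ind, this, hv, hc.symm, if_true, if_false, Finset.sum_const_zero, zero_add]
      simp
    · obtain ⟨w, hw, hvw⟩ : ∃ w ∈ W, B v w ≠ 0 := by
        by_contra! hcon
        exact hv (horth ▸ fun y hy => by simpa [hsymm y v] using hcon y hy)
      rw [if_neg hv, add_zero]
      let w₀ : W := ⟨(c / (2 * B v w)) • w, W.smul_mem _ hw⟩
      refine Fintype.sum_equiv (Equiv.addRight w₀) _ _ fun u => ?_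
      have : 2 * B v (u + w₀ : W) = 2 * B v u + c := by
        simp [w₀]; field_simp
      simp only [ind, Equiv.coe_addRight, hexp, this, ← add_assoc, add_eq_right]
  have hcard : ∀ a, Nat.card {v // B v v = a} = ∑ v, ind a v := fun a => by
    simp [ind, Nat.card_eq_fintype_card, Fintype.card_subtype]
  have hmul : Fintype.card W * ∑ v, ind 0 v =
      Fintype.card W * (∑ v, ind c v + Fintype.card W) := by
    rw [mul_add, hshift, hshift, Finset.sum_congr rfl fun v _ => hcoset v, Finset.sum_add_distrib]
    congr 1
    rw [← Finset.sum_filter, Finset.sum_const, smul_eq_mul, ← Fintype.card_subtype]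
  rw [hcard, hcard, Nat.card_eq_fintype_card]
  exact Nat.eq_of_mul_eq_mul_left Fintype.card_pos hmul

/-- A group of scalars acts freely on the non-zero vectors, so its order divides the cardinality of
every invariant set of non-zero vectors. -/
theorem card_subgroup_units_dvd_card {K V : Type*} [Field K] [AddCommGroup V] [Module K V]
    (U : Subgroup Kˣ) (P : V → Prop) (hP0 : ¬ P 0)
    (hP : ∀ u ∈ U, ∀ v, P v → P ((u : K) • v)) :
    Nat.card U ∣ Nat.card {v // P v} := by
  let X : SubMulAction U V :=
    { carrier := {v | P v}
      smul_mem' := fun u v hv => hP u u.2 v hv }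
  have hfree : ∀ x : X, MulAction.stabilizer U x = ⊥ := fun x => by
    refine (Subgroup.eq_bot_iff_forall _).mpr fun u hu => ?_
    have hu' : ((u : Kˣ) : K) • (x : V) = x := congrArg Subtype.val hu
    have hx : (x : V) ≠ 0 := fun h => hP0 (h ▸ x.2)
    have : (((u : Kˣ) : K) - 1) • (x : V) = 0 := by rw [sub_smul, hu', one_smul, sub_self]
    exact Subtype.ext (Units.ext (sub_eq_zero.mp ((smul_eq_zero.mp this).resolve_right hx)))
  have : Nat.card {v // P v} = Nat.card X := rfl
  rw [this, Nat.card_congr (MulAction.selfEquivOrbitsQuotientProd hfree), Nat.card_prod]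
  exact dvd_mul_left _ _

/-- In a field with `n ^ 2` elements, every element fixed by `x ↦ x ^ n` is of the form
`t ^ (n + 1)`. -/
theorem exists_mul_pow_eq_of_pow_eq {K : Type*} [Field K] [Fintype K] {n : ℕ} (hn : 1 < n)
    (hK : Fintype.card K = n ^ 2) {s : K} (hs : s ^ n = s) : ∃ t, t * t ^ n = s := by
  classical
  by_cases hs0 : s = 0
  · exact ⟨0, by simp [hs0]⟩
  obtain ⟨g, hg⟩ := IsCyclic.exists_monoid_generator (α := Kˣ)
  obtain ⟨j, hj⟩ := hg (Units.mk0 s hs0)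
  obtain ⟨k, rfl⟩ : ∃ k, n = k + 1 := ⟨n - 1, by omega⟩
  have hord : orderOf g = (k + 2) * k := by
    rw [orderOf_eq_card_of_forall_mem_powers hg, Nat.card_eq_fintype_card, Fintype.card_units, hK,
      Nat.sub_eq_iff_eq_add (Nat.one_le_pow _ _ (by omega))]
    ring
  have h1 : g ^ (j * k) = 1 := by
    rw [pow_mul, show g ^ j = Units.mk0 s hs0 from hj]
    ext
    rw [pow_succ] at hs
    simpa [hs0] using hs
  obtain ⟨i, rfl⟩ : k + 2 ∣ j := by
    have := orderOf_dvd_of_pow_eq_one h1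
    rw [hord] at this
    exact Nat.dvd_of_mul_dvd_mul_right (by omega) this
  refine ⟨((g ^ i : Kˣ) : K), ?_⟩
  have := congrArg Units.val hj
  simp only [Units.val_mk0] at this
  rw [← this]
  push_cast
  ring

/-- Let `q` be an odd prime power, `w = 2m` even, `K = GF(q^w)`, and
`σ(x) = x^{q^{w/2}}` the order-`2` automorphism of `K`.  Let `V` be an `A`-dimensional
`K`-vector space, `β : V × V → K` a non-degenerate hermitian form with respect to `σ`,
and `α ∈ K*` with `σ(α) = α`; set `L(x) = Tr_{K/GF(q)}(αx)`.  Then `Lβ = L ∘ β` is a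
non-degenerate symmetric `GF(q)`-bilinear form on the `Aw`-dimensional `GF(q)`-vector
space `V`, and `Lβ` admits a totally isotropic `GF(q)`-subspace of dimension `Aw/2` if
and only if `A` is even; that is, `(V, Lβ)` is of type `O⁺(Aw,q)` if `A` is even and of
type `O⁻(Aw,q)` if `A` is odd. -/
theorem stmt_17 {F K V : Type*} [Field F] [Field K] [Algebra F K]
    [AddCommGroup V] [Module K V] [Module F V] [IsScalarTower F K V]
    [Fintype F] [Fintype K] [FiniteDimensional K V]
    (q w m A : ℕ) (hq : Odd q) (hw : w = 2 * m) (hm : 0 < m)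
    (hcardF : Fintype.card F = q) (hcardK : Fintype.card K = q ^ w)
    (hA : Module.finrank K V = A)
    (β : V → V → K)
    (hβadd₁ : ∀ u v w : V, β (u + v) w = β u w + β v w)
    (hβadd₂ : ∀ u v w : V, β u (v + w) = β u v + β u w)
    (hβsmul₁ : ∀ (a : K) (v w : V), β (a • v) w = a * β v w)
    (hβsmul₂ : ∀ (a : K) (v w : V), β v (a • w) = a ^ q ^ m * β v w)
    (hβherm : ∀ v w : V, β w v = (β v w) ^ q ^ m)
    (hβnd : ∀ u : V, (∀ v : V, β u v = 0) → u = 0)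
    (α : K) (hα : α ≠ 0) (hαfix : α ^ q ^ m = α) :
    (∀ u : V, (∀ v : V, traceMul q w α (β u v) = 0) → u = 0) ∧
    (∀ v u : V, traceMul q w α (β v u) = traceMul q w α (β u v)) ∧
    Module.finrank F V = A * w ∧
    ((∃ W : Submodule F V, (∀ x ∈ W, ∀ y ∈ W, traceMul q w α (β x y) = 0) ∧
        Module.finrank F W = A * w / 2) ↔ Even A) := by
  subst hw
  have hq1 : 1 < q := hcardF ▸ Fintype.one_lt_card
  have hn1 : 1 < q ^ m := Nat.one_lt_pow hm.ne' hq1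
  have hKn : Fintype.card K = (q ^ m) ^ 2 := by rw [hcardK, ← pow_mul, mul_comm]
  have hfinK : finrank F K = 2 * m := by
    have := Module.card_eq_pow_finrank (K := F) (V := K)
    rw [hcardK, hcardF] at this
    exact (Nat.pow_right_injective hq1 this).symm
  have : FiniteDimensional F V := FiniteDimensional.trans F K V
  have : Finite V := Module.finite_of_finite K
  have hfinV : finrank F V = A * (2 * m) := by
    rw [← finrank_mul_finrank F K V, hfinK, hA, mul_comm]
  let τ : K ≃ₐ[F] K := FiniteField.frobeniusAlgEquivOfAlgebraic F K ^ m
  have hτ : ∀ x, τ x = x ^ q ^ m := fun x => by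
    have := congrFun (FiniteField.coe_frobeniusAlgEquivOfAlgebraic_iterate F K m) x
    rw [hcardF] at this
    rw [← this]
    exact congrFun (AlgEquiv.coe_pow _ _) x
  let σ : K →+* K := (τ : K →+* K)
  have hσ : ∀ x, σ x = x ^ q ^ m := hτ
  let β' : V →ₗ[K] V →ₛₗ[σ] K := LinearMap.mk₂'ₛₗ (RingHom.id K) σ β hβadd₁ hβsmul₁ hβadd₂
    fun a v w => by rw [hσ, smul_eq_mul, hβsmul₂]
  have hFτ : ∀ a : F, algebraMap F K a ^ q ^ m = algebraMap F K a := fun a => by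
    rw [← hτ, AlgEquiv.commutes]
  have hβF : ∀ (a : F) (v w : V), β v (a • w) = a • β v w := fun a v w => by
    rw [← algebraMap_smul K a w, hβsmul₂, hFτ, Algebra.smul_def]
  have hβF' : ∀ (a : F) (v w : V), β (a • v) w = a • β v w := fun a v w => by
    rw [← algebraMap_smul K a v, hβsmul₁, Algebra.smul_def]
  let B : LinearMap.BilinForm F V := LinearMap.mk₂ F (fun v w => Algebra.trace F K (α * β v w))
    (fun u v w => by rw [hβadd₁, mul_add, map_add])
    (fun a v w => by rw [hβF', mul_smul_comm, map_smul])
    (fun u v w => by rw [hβadd₂, mul_add, map_add])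
    (fun a v w => by rw [hβF, mul_smul_comm, map_smul])
  have htr : ∀ x, traceMul q (2 * m) α x = algebraMap F K (Algebra.trace F K (α * x)) := fun x => by
    rw [FiniteField.algebraMap_trace_eq_sum_pow, hfinK, Nat.card_eq_fintype_card, hcardF]
    rfl
  have htr0 : ∀ v w, traceMul q (2 * m) α (β v w) = 0 ↔ B v w = 0 := fun v w => by
    rw [htr, map_eq_zero]
    rfl
  have hsymm : ∀ v w, B v w = B w v := fun v w => by
    change Algebra.trace F K (α * β v w) = Algebra.trace F K (α * β w v)
    have : α * β w v = τ (α * β v w) := by rw [hτ, mul_pow, hαfix, hβherm v w]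
    rw [this, Algebra.trace_eq_of_algEquiv]
  have hnd : ∀ u, (∀ v, B u v = 0) → u = 0 := fun u hu => by
    refine hβnd u fun v => ?_
    suffices α * β u v = 0 from (mul_eq_zero.mp this).resolve_left hα
    refine (traceForm_nondegenerate F K).1 _ fun b => ?_
    have := hu (τ.symm b • v)
    rw [Algebra.traceForm_apply]
    change Algebra.trace F K (α * β u (τ.symm b • v)) = 0 at this
    rwa [hβsmul₂, ← hτ, AlgEquiv.apply_symm_apply, mul_left_comm, mul_comm] at this
  refine ⟨fun u hu => hnd u fun v => (htr0 u v).mp (hu v), fun v u => ?_, hfinV, ?_, ?_⟩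
  · rw [htr, htr]
    exact congrArg _ (hsymm v u)
  · rintro ⟨W, hW, hWdim⟩
    have hWm : finrank F W = m * A := by
      rw [hWdim, show A * (2 * m) = 2 * (m * A) by ring, Nat.mul_div_cancel_left _ two_pos]
    by_contra hodd
    rw [Nat.not_even_iff_odd] at hodd
    have h2 : (2 : F) ≠ 0 := Ring.two_ne_zero fun h => by
      have := FiniteField.even_card_of_char_two h
      rw [hcardF] at this
      have := Nat.odd_iff.mp hq
      omega
    have hcount := card_norm_eq_zero_of_isotropic h2 B
      (LinearMap.IsRefl.nondegenerate_iff_separatingLeft (fun x y h => by rw [hsymm, h]) |>.mpr hnd)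
      hsymm W (fun x hx y hy => (htr0 x y).mp (hW x hx y hy)) (by rw [hfinV, hWm]; ring)
      (one_ne_zero (α := F))
    have hWcard : Nat.card W = (q ^ m) ^ A := by
      have := Fintype.ofFinite W
      rw [Nat.card_eq_fintype_card, Module.card_eq_pow_finrank (K := F), hcardF, hWm, pow_mul]
    classical
    let U : Subgroup Kˣ := (powMonoidHom (q ^ m + 1)).ker
    have hU : Nat.card U = q ^ m + 1 := by
      rw [IsCyclic.card_powMonoidHom_ker, Nat.card_eq_fintype_card, Fintype.card_units, hKn]
      refine Nat.gcd_eq_right ⟨q ^ m - 1, ?_⟩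
      simpa using Nat.sq_sub_sq (q ^ m) 1
    have hUB : ∀ u ∈ U, ∀ v, B ((u : K) • v) ((u : K) • v) = B v v := fun u hu v => by
      have hu' : (u : K) * (u : K) ^ q ^ m = 1 := by
        rw [← pow_succ']
        have : u ^ (q ^ m + 1) = 1 := hu
        rw [← Units.val_pow_eq_pow_val, this, Units.val_one]
      change Algebra.trace F K (α * β _ _) = Algebra.trace F K (α * β v v)
      rw [hβsmul₁, hβsmul₂, ← mul_assoc (u : K), hu', one_mul]
    have hd₁ : q ^ m + 1 ∣ Nat.card {v // B v v = 1} := hU ▸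
      card_subgroup_units_dvd_card U (fun v => B v v = 1) (by simp) fun u hu v hv => by
        rw [hUB u hu, hv]
    have hd₀ : q ^ m + 1 ∣ Nat.card {v // v ≠ 0 ∧ B v v = 0} := hU ▸
      card_subgroup_units_dvd_card U (fun v => v ≠ 0 ∧ B v v = 0) (by simp) fun u hu v hv =>
        ⟨smul_ne_zero u.ne_zero hv.1, by rw [hUB u hu, hv.2]⟩
    have hzero : Nat.card {v // B v v = 0} = Nat.card {v // v ≠ 0 ∧ B v v = 0} + 1 := by
      have : {v | B v v = 0} = insert 0 {v | v ≠ 0 ∧ B v v = 0} := by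
        ext v
        by_cases hv : v = 0 <;> simp [hv]
      have h := Set.ncard_insert_of_notMem (a := (0 : V)) (s := {v | v ≠ 0 ∧ B v v = 0}) (by simp)
      rw [← this] at h
      exact h
    have hd₂ : q ^ m + 1 ∣ (q ^ m) ^ A + 1 := by
      simpa using hodd.nat_add_dvd_pow_add_pow (q ^ m) 1
    rw [hzero, hWcard] at hcount
    have hd : q ^ m + 1 ∣ 2 := by
      have h₁ := (Nat.dvd_add_right hd₁).mpr hd₂
      rw [← add_assoc, ← hcount, add_assoc] at h₁
      exact (Nat.dvd_add_right hd₀).mp h₁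
    have := Nat.le_of_dvd two_pos hd
    omega
  · rintro ⟨a, rfl⟩
    obtain ⟨W, hW, hWdim⟩ := exists_isotropic_of_norm_surjective β'
      (fun v w => by rw [hσ]; exact hβherm v w)
      (fun s hs => by
        simp_rw [hσ] at hs ⊢
        exact exists_mul_pow_eq_of_pow_eq hn1 hKn hs) a (by omega)
    refine ⟨W.restrictScalars F, fun x hx y hy => ?_, ?_⟩
    · have : β x y = 0 := hW x hx y hy
      rw [htr, this, mul_zero, map_zero, map_zero]
    · have : finrank F (W.restrictScalars F) = finrank F W := rfl
      rw [this, ← finrank_mul_finrank F K W, hfinK, hWdim,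
        show (a + a) * (2 * m) = 2 * (2 * m * a) by ring, Nat.mul_div_cancel_left _ two_pos]
end
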